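/- Let d | q-1 with d ≠ 1, let (γ^((q-1)/d), 0, H) ∈ S, and let H' = {x ∈ F_q : xH ⊆ H} (the largest subfield K of F_q such that H is a K-module). Then the minimal elements of the set of subgroups K of AGL(1,F_q) with S(γ^((q-1)/d), 0, H) < K (strict containment) are precisely: (a) the subgroups S(γ^((q-1)/(d·e)), 0, H) for primes e dividing (|H'|-1)/d, and (b) the subgroups S(γ^((q-1)/d), 0, H1) where H1 is an additive subgroup of F_q with H ⊆ H1, (γ^((q-1)/d), 0, H1) ∈ S, and H1/H is a one-dimensional vector space over F_{p(d)}. -/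

import Mathlib

open Matrix
open scoped Classical

abbrev GL2 (F : Type) [Field F] := GL (Fin 2) F

/-- `AGL(1,F)`: the subgroup of `GL(2,F)` of matrices of the form `[[a,b],[0,1]]`. -/
def AGL (F : Type) [Field F] : Subgroup (GL2 F) where
  carrier := {g | (g : Matrix (Fin 2) (Fin 2) F) 1 0 = 0 ∧
                  (g : Matrix (Fin 2) (Fin 2) F) 1 1 = 1}
  one_mem' := by
    constructor <;> simp [Matrix.one_apply]
  mul_mem' := by
    rintro a b ⟨ha0, ha1⟩ ⟨hb0, hb1⟩
    constructor <;>
      simp [Units.val_mul, Matrix.mul_apply, Fin.sum_univ_two, ha0, ha1, hb0, hb1]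
  inv_mem' := by
    rintro g ⟨h0, h1⟩
    have hdet : ((g : Matrix (Fin 2) (Fin 2) F) 0 0) ≠ 0 := by
      have hu : IsUnit ((g : Matrix (Fin 2) (Fin 2) F).det) :=
        (Matrix.isUnit_iff_isUnit_det _).1 g.isUnit
      rw [Matrix.det_fin_two, h0, h1] at hu
      simpa using hu.ne_zero
    have hinv : ((g⁻¹ : GL2 F) : Matrix (Fin 2) (Fin 2) F)
        = ((g : Matrix (Fin 2) (Fin 2) F))⁻¹ := Matrix.coe_units_inv g
    constructor <;>
      simp [hinv, Matrix.inv_def, Matrix.adjugate_fin_two, Matrix.det_fin_two,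
        h0, h1, hdet]

/-- Membership of a triple `(a,b,H)` in the set `𝒮`: `a ∈ F*`, `H` is an additive
subgroup of `F` closed under multiplication by the subfield `F_p(a)` generated by `a`,
and `b = 0` when `a = 1`. -/
def memS {F : Type} [Field F] (a b : F) (H : AddSubgroup F) : Prop :=
  a ≠ 0 ∧ (a = 1 → b = 0) ∧ ∀ x ∈ Subfield.closure {a}, ∀ h ∈ H, x * h ∈ H

/-- `S(a,b,H)`: the subgroup of `GL(2,F)` generated by the matrix `[[a,b],[0,1]]`
together with the matrices `[[1,h],[0,1]]`, `h ∈ H`. -/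
def Sgrp {F : Type} [Field F] (a b : F) (H : AddSubgroup F) : Subgroup (GL2 F) :=
  Subgroup.closure {g : GL2 F |
    (g : Matrix (Fin 2) (Fin 2) F) = !![a, b; 0, 1] ∨
    ∃ h ∈ H, (g : Matrix (Fin 2) (Fin 2) F) = !![1, h; 0, 1]}

/-- `pPow p d` is `p(d)`: the smallest (positive) power of `p` that is `≡ 1 (mod d)`. -/
noncomputable def pPow (p d : ℕ) : ℕ := sInf {m | (∃ k : ℕ, 1 ≤ k ∧ m = p ^ k) ∧ m % d = 1 % d}

section helpers
variable {F : Type} [Field F]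

/-- the affine matrix -/
noncomputable def MM (u : Fˣ) (b : F) : GL2 F :=
  ⟨!![(u:F), b; 0, 1], !![((u⁻¹ : Fˣ) : F), -(((u⁻¹ : Fˣ) : F) * b); 0, 1],
   by ext i j; fin_cases i <;> fin_cases j <;> simp [Matrix.mul_apply, Fin.sum_univ_two],
   by ext i j; fin_cases i <;> fin_cases j <;> simp [Matrix.mul_apply, Fin.sum_univ_two]⟩

lemma MM_val (u : Fˣ) (b : F) :
    ((MM u b : GL2 F) : Matrix (Fin 2) (Fin 2) F) = !![(u:F), b; 0, 1] := rfl

lemma MM_mul (u v : Fˣ) (b c : F) : MM u b * MM v c = MM (u * v) (u * c + b) := by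
  apply Units.ext
  rw [Units.val_mul, MM_val, MM_val, MM_val]
  ext i j; fin_cases i <;> fin_cases j <;> simp [Matrix.mul_apply, Fin.sum_univ_two]

lemma MM_inj {u v : Fˣ} {b c : F} (h : MM u b = MM v c) : u = v ∧ b = c := by
  have h' := congrArg (fun g : GL2 F => (g : Matrix (Fin 2) (Fin 2) F)) h
  simp only [MM_val] at h'
  have h0 := congrFun (congrFun h' 0) 0
  have h1 := congrFun (congrFun h' 0) 1
  simp at h0 h1
  exact ⟨Units.ext h0, h1⟩

lemma MM_one : MM (1 : Fˣ) (0 : F) = 1 := by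
  apply Units.ext
  rw [MM_val]
  ext i j; fin_cases i <;> fin_cases j <;> simp

lemma MM_inv (u : Fˣ) (b : F) : (MM u b)⁻¹ = MM u⁻¹ (-(((u⁻¹ : Fˣ) : F) * b)) := by
  rw [inv_eq_iff_mul_eq_one, MM_mul, ← MM_one]
  simp

lemma MM_mem_AGL (u : Fˣ) (b : F) : MM u b ∈ AGL F := by
  constructor <;> simp [MM_val]

lemma exists_MM {g : GL2 F} (hg : g ∈ AGL F) : ∃ u b, g = MM u b := by
  obtain ⟨h0, h1⟩ := hg
  have hu : IsUnit ((g : Matrix (Fin 2) (Fin 2) F).det) :=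
    (Matrix.isUnit_iff_isUnit_det _).1 g.isUnit
  rw [Matrix.det_fin_two, h0, h1] at hu
  simp only [mul_one, mul_zero, sub_zero] at hu
  refine ⟨hu.unit, (g : Matrix (Fin 2) (Fin 2) F) 0 1, Units.ext ?_⟩
  rw [MM_val]
  ext i j; fin_cases i <;> fin_cases j <;> simp [h0, h1]

/-- semidirect product -/
def GG (A : Subgroup Fˣ) (H : AddSubgroup F) (hst : ∀ u ∈ A, ∀ h ∈ H, (u:F) * h ∈ H) :
    Subgroup (GL2 F) where
  carrier := {g | ∃ u ∈ A, ∃ h ∈ H, g = MM u h}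
  one_mem' := ⟨1, A.one_mem, 0, H.zero_mem, MM_one.symm⟩
  mul_mem' := by
    rintro _ _ ⟨u, hu, h, hh, rfl⟩ ⟨v, hv, k, hk, rfl⟩
    exact ⟨u * v, A.mul_mem hu hv, u * k + h, H.add_mem (hst u hu k hk) hh, MM_mul _ _ _ _⟩
  inv_mem' := by
    rintro _ ⟨u, hu, h, hh, rfl⟩
    exact ⟨u⁻¹, A.inv_mem hu, _, H.neg_mem (hst _ (A.inv_mem hu) h hh), MM_inv _ _⟩

lemma mem_GG {A : Subgroup Fˣ} {H : AddSubgroup F} {hst} {u : Fˣ} {b : F} :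
    MM u b ∈ GG A H hst ↔ u ∈ A ∧ b ∈ H := by
  constructor
  · rintro ⟨v, hv, h, hh, e⟩
    obtain ⟨rfl, rfl⟩ := MM_inj e
    exact ⟨hv, hh⟩
  · rintro ⟨hu, hb⟩
    exact ⟨u, hu, b, hb, rfl⟩

lemma GG_le_AGL {A : Subgroup Fˣ} {H : AddSubgroup F} {hst} : GG A H hst ≤ AGL F := by
  rintro _ ⟨v, hv, h, hh, rfl⟩
  exact MM_mem_AGL _ _

lemma GG_le {A A' : Subgroup Fˣ} {H H' : AddSubgroup F} {hst hst'} :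
    GG A H hst ≤ GG A' H' hst' ↔ A ≤ A' ∧ H ≤ H' := by
  constructor
  · intro h
    constructor
    · intro u hu
      exact (mem_GG.1 (h (mem_GG.2 ⟨hu, H.zero_mem⟩))).1
    · intro b hb
      exact (mem_GG.1 (h (mem_GG.2 ⟨A.one_mem, hb⟩))).2
  · rintro ⟨h1, h2⟩ _ ⟨v, hv, h, hh, rfl⟩
    exact mem_GG.2 ⟨h1 hv, h2 hh⟩

lemma GG_eq {A A' : Subgroup Fˣ} {H H' : AddSubgroup F} {hst hst'} :
    GG A H hst = GG A' H' hst' ↔ A = A' ∧ H = H' := by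
  constructor
  · intro h
    have h1 := GG_le.1 h.le
    have h2 := GG_le.1 h.ge
    exact ⟨le_antisymm h1.1 h2.1, le_antisymm h1.2 h2.2⟩
  · rintro ⟨rfl, rfl⟩; rfl

/-- stabilizer subfield -/
def stabF [Fintype F] (H : AddSubgroup F) : Subfield F where
  carrier := {x | ∀ h ∈ H, x * h ∈ H}
  mul_mem' := by
    intro a b ha hb h hh
    rw [mul_assoc]; exact ha _ (hb _ hh)
  one_mem' := by intro h hh; simpa using hh
  add_mem' := by
    intro a b ha hb h hh
    rw [add_mul]; exact H.add_mem (ha _ hh) (hb _ hh)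
  zero_mem' := by intro h hh; simp [H.zero_mem]
  neg_mem' := by
    intro a ha h hh
    rw [neg_mul]; exact H.neg_mem (ha _ hh)
  inv_mem' := by
    intro x hx h hh
    by_cases h0 : x = 0
    · simp [h0, H.zero_mem]
    have key : ∀ n : ℕ, ∀ h ∈ H, x ^ n * h ∈ H := by
      intro n
      induction n with
      | zero => intro h hh; simpa using hh
      | succ n ih => intro h hh; rw [pow_succ, mul_assoc]; exact ih _ (hx _ hh)
    have e : x⁻¹ = x ^ (Fintype.card F - 2) := by
      have h1 := FiniteField.pow_card_sub_one_eq_one x h0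
      have h2 : 1 < Fintype.card F := Fintype.one_lt_card
      have h3 : Fintype.card F - 1 = (Fintype.card F - 2) + 1 := by omega
      rw [h3, pow_succ] at h1
      exact (eq_inv_of_mul_eq_one_left h1).symm
    rw [e]; exact key _ _ hh

lemma mem_stabF [Fintype F] {H : AddSubgroup F} {x : F} :
    x ∈ stabF H ↔ ∀ h ∈ H, x * h ∈ H := Iff.rfl

/-- stabilizer units -/
def stabU [Fintype F] (H : AddSubgroup F) : Subgroup Fˣ where
  carrier := {u | (u : F) ∈ stabF H}
  one_mem' := by simpa using (stabF H).one_mem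
  mul_mem' := by intro a b ha hb; simpa using (stabF H).mul_mem ha hb
  inv_mem' := by intro a ha; simpa using (stabF H).inv_mem ha

lemma mem_stabU [Fintype F] {H : AddSubgroup F} {x : Fˣ} :
    x ∈ stabU H ↔ ∀ h ∈ H, (x:F) * h ∈ H := Iff.rfl

lemma card_stabU [Fintype F] (H : AddSubgroup F) :
    Nat.card (stabU H) = Nat.card {x : F | ∀ h ∈ H, x * h ∈ H} - 1 := by
  have h : Nat.card (stabF H) = Nat.card {x : F | ∀ h ∈ H, x * h ∈ H} := rfl
  rw [← h, ← Nat.card_units]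
  have hr : stabU H = (Units.map ((stabF H).subtype : stabF H →* F)).range := by
    ext u
    constructor
    · intro hu
      refine ⟨Units.mk0 ⟨(u:F), hu⟩ (fun h => u.ne_zero (congrArg Subtype.val h)), ?_⟩
      ext; rfl
    · rintro ⟨v, rfl⟩
      exact (v : stabF H).2
  rw [hr]
  refine (Nat.card_congr (MonoidHom.ofInjective ?_).toEquiv).symm
  exact Units.map_injective (stabF H).subtype_injective

lemma mem_of_pow_card [Fintype F] (A : Subgroup Fˣ) (u : Fˣ) (h : u ^ Nat.card A = 1) :
    u ∈ A := by
  have h1 : (Finset.univ.filter (fun x : Fˣ => x ∈ A)) ⊆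
      (Finset.univ.filter (fun x : Fˣ => x ^ Nat.card A = 1)) := by
    intro x hx
    simp only [Finset.mem_filter, Finset.mem_univ, true_and] at hx ⊢
    exact orderOf_dvd_iff_pow_eq_one.1 (Subgroup.orderOf_dvd_natCard A hx)
  have h2 := IsCyclic.card_pow_eq_one_le (α := Fˣ) (n := Nat.card A) Nat.card_pos
  have h3 : (Finset.univ.filter (fun x : Fˣ => x ∈ A)).card = Nat.card A := by
    rw [Nat.card_eq_fintype_card, Fintype.card_subtype]
  have h4 := Finset.eq_of_subset_of_card_le h1 (by rw [h3]; convert h2)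
  have : u ∈ (Finset.univ.filter (fun x : Fˣ => x ^ Nat.card A = 1)) := by
    rw [Finset.mem_filter]; exact ⟨Finset.mem_univ _, h⟩
  rw [← h4] at this
  simpa using this

lemma Sgrp_eq [Fintype F] (c : Fˣ) (H : AddSubgroup F) (hc : c ∈ stabU H) :
    Sgrp (c : F) 0 H = GG (Subgroup.zpowers c) H
      (fun _ hu => mem_stabU.1 ((Subgroup.zpowers_le.2 hc) hu)) := by
  have hcS : MM c 0 ∈ Sgrp (c : F) 0 H := Subgroup.subset_closure (Or.inl rfl)
  have hhS : ∀ h ∈ H, MM 1 h ∈ Sgrp (c : F) 0 H := fun h hh =>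
    Subgroup.subset_closure (Or.inr ⟨h, hh, by simp [MM_val]⟩)
  apply le_antisymm
  · unfold Sgrp
    rw [Subgroup.closure_le]
    rintro g (hg | ⟨h, hh, hg⟩)
    · have : g = MM c 0 := Units.ext hg
      rw [this]
      exact mem_GG.2 ⟨Subgroup.mem_zpowers c, H.zero_mem⟩
    · have : g = MM 1 h := Units.ext (by rw [hg, MM_val]; simp)
      rw [this]
      exact mem_GG.2 ⟨Subgroup.one_mem _, hh⟩
  · rintro _ ⟨u, hu, h, hh, rfl⟩
    obtain ⟨k, rfl⟩ := Subgroup.mem_zpowers_iff.1 hu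
    let f : Fˣ →* GL2 F := ⟨⟨fun u => MM u 0, MM_one⟩, fun u v => by
      show MM (u*v) 0 = MM u 0 * MM v 0
      rw [MM_mul]; simp⟩
    have e : MM (c ^ k) 0 = (MM c 0) ^ k := map_zpow f c k
    have : MM (c ^ k) h = MM 1 h * MM (c^k) 0 := by rw [MM_mul]; simp
    rw [this, e]
    exact Subgroup.mul_mem _ (hhS h hh) (Subgroup.zpow_mem _ hcS k)

/-- structure of overgroups -/
lemma exists_GG [Fintype F] (a : Fˣ) (ha : a ≠ 1) (K : Subgroup (GL2 F)) (hK : K ≤ AGL F)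
    (haK : MM a 0 ∈ K) :
    ∃ (A : Subgroup Fˣ) (H : AddSubgroup F) (hst : ∀ u ∈ A, ∀ h ∈ H, (u:F) * h ∈ H),
      K = GG A H hst := by
  let A : Subgroup Fˣ :=
    { carrier := {u | MM u 0 ∈ K}
      one_mem' := by show MM 1 0 ∈ K; rw [MM_one]; exact K.one_mem
      mul_mem' := by
        intro u v hu hv
        have := K.mul_mem hu hv
        rw [MM_mul] at this; simpa using this
      inv_mem' := by
        intro u hu
        have := K.inv_mem hu
        rw [MM_inv] at this; simpa using this }
  let H : AddSubgroup F :=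
    { carrier := {h | MM 1 h ∈ K}
      zero_mem' := by show MM 1 0 ∈ K; rw [MM_one]; exact K.one_mem
      add_mem' := by
        intro u v hu hv
        have := K.mul_mem hv hu
        rw [MM_mul] at this; simpa using this
      neg_mem' := by
        intro u hu
        have := K.inv_mem hu
        rw [MM_inv] at this; simpa using this }
  have conj : ∀ (u : Fˣ) (b : F), MM u b ∈ K → ∀ h ∈ H, (u:F) * h ∈ H := by
    intro u b hu h hh
    have := K.mul_mem (K.mul_mem hu hh) (K.inv_mem hu)
    rw [MM_inv, MM_mul, MM_mul] at this
    show MM 1 _ ∈ K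
    convert this using 2
    · simp
    · simp
  have hst : ∀ u ∈ A, ∀ h ∈ H, (u:F) * h ∈ H := fun u hu => conj u 0 hu
  refine ⟨A, H, hst, le_antisymm ?_ ?_⟩
  · intro g hg
    obtain ⟨u, b, rfl⟩ := exists_MM (hK hg)
    have h1 := K.mul_mem (K.mul_mem (K.mul_mem haK hg) (K.inv_mem haK)) (K.inv_mem hg)
    have hb : ((a:F) - 1) * b ∈ H := by
      show MM 1 _ ∈ K
      rw [MM_inv, MM_inv, MM_mul, MM_mul, MM_mul] at h1
      convert h1 using 2
      · rw [mul_comm a u]; simp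
      · simp; ring
    have haF : (a:F) ∈ stabF H := hst a haK
    have hb2 : b ∈ H := by
      have h2 := (stabF H).inv_mem ((stabF H).sub_mem haF (stabF H).one_mem)
      have h3 := mem_stabF.1 h2 _ hb
      have hne : (a:F) - 1 ≠ 0 := by
        intro h; apply ha; ext; simpa [sub_eq_zero] using h
      rwa [inv_mul_cancel_left₀ hne] at h3
    refine mem_GG.2 ⟨?_, hb2⟩
    have h4 := K.mul_mem (K.inv_mem hb2) hg
    rw [MM_inv, MM_mul] at h4
    show MM u 0 ∈ K
    simpa using h4
  · rintro _ ⟨u, hu, h, hh, rfl⟩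
    have := K.mul_mem hh hu
    rw [MM_mul] at this; simpa using this

lemma card_closure [Fintype F] (p d : ℕ) (hp : p.Prime) (hchar : ringChar F = p)
    (a : Fˣ) (ho : orderOf a = d) (hd : d ≠ 1) :
    Nat.card (Subfield.closure {(a:F)}) = pPow p d := by
  haveI : Fact p.Prime := ⟨hp⟩
  haveI : CharP F p := by rw [← hchar]; exact ringChar.charP F
  have hd0 : 0 < d := ho ▸ orderOf_pos a
  set k := Subfield.closure {(a:F)} with hk
  have hak : (a:F) ∈ k := Subfield.subset_closure rfl
  haveI : CharP k p := by infer_instance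
  symm
  unfold pPow
  apply IsLeast.csInf_eq
  constructor
  · obtain ⟨n, _, hn⟩ := FiniteField.card k p
    refine ⟨⟨n, n.pos, ?_⟩, ?_⟩
    · rw [Nat.card_eq_fintype_card, hn]
    · have h1 : a ^ (Nat.card k - 1) = 1 := by
        have hne : (⟨a, hak⟩ : k) ≠ 0 := fun h => a.ne_zero (congrArg Subtype.val h)
        have := FiniteField.pow_card_sub_one_eq_one (⟨a, hak⟩ : k) hne
        ext
        rw [Nat.card_eq_fintype_card]
        simpa using congrArg Subtype.val this
      have h2 := orderOf_dvd_of_pow_eq_one h1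
      rw [ho] at h2
      have h3 : 1 ≤ Nat.card k := Nat.card_pos
      exact ((Nat.modEq_iff_dvd' h3).2 h2).symm
  · rintro m ⟨⟨j, hj, rfl⟩, hm⟩
    have hap : a ^ (p ^ j) = a := by
      have : p ^ j ≡ 1 [MOD orderOf a] := by rw [ho]; exact hm
      have := pow_eq_pow_iff_modEq.2 this
      simpa using this
    have hle : ∀ x ∈ k, x ^ (p ^ j) = x := by
      intro x hx
      induction hx using Subfield.closure_induction with
      | mem x hx =>
        rw [Set.mem_singleton_iff] at hx
        rw [hx]; exact_mod_cast congrArg Units.val hap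
      | one => simp
      | add x y _ _ hx hy => rw [add_pow_char_pow, hx, hy]
      | neg x _ hx =>
        have : (iterateFrobenius F p j) (-x) = - x := by rw [map_neg]; simp [iterateFrobenius_def, hx]
        simpa [iterateFrobenius_def] using this
      | inv x _ hx => rw [inv_pow, hx]
      | mul x y _ _ hx hy => rw [mul_pow, hx, hy]
    have h1 : 1 < p ^ j := Nat.one_lt_pow (by omega) hp.one_lt
    have hne := FiniteField.X_pow_card_sub_X_ne_zero F h1
    have hdeg := FiniteField.X_pow_card_sub_X_natDegree_eq F h1
    have hsub : (Finset.univ.filter (fun x : F => x ∈ k)) ⊆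
        (Polynomial.X ^ (p^j) - Polynomial.X : Polynomial F).roots.toFinset := by
      intro x hx
      simp only [Finset.mem_filter, Finset.mem_univ, true_and] at hx
      rw [Multiset.mem_toFinset, Polynomial.mem_roots hne]
      simp [hle x hx]
    calc Nat.card k = (Finset.univ.filter (fun x : F => x ∈ k)).card := by
          rw [Nat.card_eq_fintype_card, Fintype.card_subtype]
      _ ≤ _ := Finset.card_le_card hsub
      _ ≤ _ := Multiset.toFinset_card_le _
      _ ≤ _ := Polynomial.card_roots' _
      _ = _ := hdeg

/-- one step extension -/
lemma exists_ext [Fintype F] (k : Subfield F) (H : AddSubgroup F) (hk : k ≤ stabF H) (x : F)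
    (hx : x ∉ H) : ∃ H2 : AddSubgroup F, H ≤ H2 ∧ x ∈ H2 ∧ k ≤ stabF H2 ∧
      Nat.card H2 = Nat.card H * Nat.card k ∧
      ∀ H3 : AddSubgroup F, H ≤ H3 → x ∈ H3 → k ≤ stabF H3 → H2 ≤ H3 := by
  let f : H × k →+ F :=
    { toFun := fun z => z.1 + z.2 * x
      map_zero' := by simp
      map_add' := by intro y z; simp; ring }
  refine ⟨f.range, ?_, ?_, ?_, ?_, ?_⟩
  · intro h hh; exact ⟨(⟨h, hh⟩, 0), by simp [f]⟩
  · exact ⟨(0, 1), by simp [f]⟩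
  · rintro c hc _ ⟨⟨h, y⟩, rfl⟩
    refine ⟨(⟨c * h, hk hc _ h.2⟩, ⟨c, hc⟩ * y), ?_⟩
    simp [f]; ring
  · rw [← Nat.card_prod]
    refine (Nat.card_congr (AddMonoidHom.ofInjective (f := f) ?_).toEquiv).symm
    rw [injective_iff_map_eq_zero]
    rintro ⟨h, y⟩ hz
    have hz' : (h:F) + y * x = 0 := hz
    by_cases hy : (y : F) = 0
    · rw [hy] at hz'
      ext <;> simp_all
    · exfalso
      apply hx
      have h1 := hk (k.inv_mem y.2) _ (H.neg_mem h.2)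
      have : x = (y:F)⁻¹ * (-h) := by
        field_simp; linear_combination hz'
      rwa [this]
  · rintro H3 h1 h2 h3 _ ⟨⟨h, y⟩, rfl⟩
    exact H3.add_mem (h1 h.2) (h3 y.2 _ h2)

end helpers

/-- For `d ∣ q-1`, `d ≠ 1`, `(γ^((q-1)/d),0,H) ∈ 𝒮`, and
`H' = {x ∈ F_q : xH ⊆ H}`, the minimal subgroups of `AGL(1,F_q)` strictly
containing `S(γ^((q-1)/d),0,H)` are precisely:
(a) `S(γ^((q-1)/(d·e)),0,H)` for primes `e ∣ (|H'|-1)/d`, and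
(b) `S(γ^((q-1)/d),0,H₁)` with `H ⊆ H₁`, `(γ^((q-1)/d),0,H₁) ∈ 𝒮`, and `H₁/H`
one-dimensional over `F_{p(d)}` (i.e. `|H₁| = |H|·p(d)`). -/
theorem stmt16 (F : Type) [Field F] [Fintype F] (p q : ℕ) (hp : p.Prime)
    (hchar : ringChar F = p) (hq : Fintype.card F = q)
    (γ : F) (hγ0 : γ ≠ 0) (hγ : ∀ x : F, x ≠ 0 → ∃ k : ℕ, x = γ ^ k)
    (d : ℕ) (hd : d ∣ q - 1) (hdne : d ≠ 1) (H : AddSubgroup F)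
    (hS : memS (γ ^ ((q - 1) / d)) 0 H)
    (K : Subgroup (GL2 F)) :
    ((Sgrp (γ ^ ((q - 1) / d)) 0 H < K ∧ K ≤ AGL F) ∧
      ∀ K' : Subgroup (GL2 F),
        (Sgrp (γ ^ ((q - 1) / d)) 0 H < K' ∧ K' ≤ AGL F) → K' ≤ K → K' = K) ↔
    ((∃ e : ℕ, e.Prime ∧
        e ∣ (Nat.card {x : F | ∀ h ∈ H, x * h ∈ H} - 1) / d ∧
        K = Sgrp (γ ^ ((q - 1) / (d * e))) 0 H) ∨
      (∃ H1 : AddSubgroup F, H ≤ H1 ∧ memS (γ ^ ((q - 1) / d)) 0 H1 ∧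
        Nat.card H1 = Nat.card H * pPow p d ∧
        K = Sgrp (γ ^ ((q - 1) / d)) 0 H1)) := by
  have hq1 : 1 < q := hq ▸ Fintype.one_lt_card
  obtain ⟨g, rfl⟩ : ∃ g : Fˣ, γ = g := ⟨Units.mk0 γ hγ0, rfl⟩
  have hgo : orderOf g = q - 1 := by
    rw [orderOf_eq_card_of_forall_mem_zpowers, Nat.card_units, Nat.card_eq_fintype_card, hq]
    intro x
    obtain ⟨k, hk⟩ := hγ x x.ne_zero
    exact ⟨k, by ext; simp [hk]⟩
  have hd0 : 0 < d := Nat.pos_of_dvd_of_pos hd (by omega)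
  have hpo : ∀ m, m ∣ q - 1 → orderOf (g ^ ((q - 1) / m)) = m := by
    intro m hm
    have hm0 : 0 < m := Nat.pos_of_dvd_of_pos hm (by omega)
    have h1 : (q - 1) / m ∣ q - 1 := Nat.div_dvd_of_dvd hm
    rw [orderOf_pow, hgo, Nat.gcd_eq_right h1, Nat.div_div_self hm (by omega)]
  have hcoe : ∀ n : ℕ, ((g : F) ^ n) = ((g ^ n : Fˣ) : F) := by intro n; simp
  simp only [hcoe] at hS ⊢
  set a : Fˣ := g ^ ((q - 1) / d) with ha
  have hao : orderOf a = d := hpo d hd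
  have ha1 : a ≠ 1 := by
    intro h; rw [h, orderOf_one] at hao; exact hdne hao.symm
  have hkc := card_closure p d hp hchar a hao hdne
  set k := Subfield.closure {(a:F)} with hk
  have hak : (a:F) ∈ k := Subfield.subset_closure rfl
  have hkle : ∀ H1 : AddSubgroup F, k ≤ stabF H1 ↔ a ∈ stabU H1 := by
    intro H1
    constructor
    · intro h; exact h hak
    · intro h; rw [hk, Subfield.closure_le, Set.singleton_subset_iff]; exact h
  have hmemS : ∀ H1 : AddSubgroup F, memS (a:F) 0 H1 ↔ a ∈ stabU H1 := by
    intro H1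
    rw [← hkle]
    exact ⟨fun h => h.2.2, fun h => ⟨a.ne_zero, fun _ => rfl, h⟩⟩
  have haH : a ∈ stabU H := (hmemS H).1 hS
  have hk1 : 1 < Nat.card k := by
    rw [Nat.card_eq_fintype_card]; exact Fintype.one_lt_card
  have hcd : Nat.card (Subgroup.zpowers a) = d := by rw [Nat.card_zpowers, hao]
  have hdS : d ∣ Nat.card (stabU H) := by
    rw [← hcd]; exact Subgroup.card_dvd_of_le (Subgroup.zpowers_le.2 haH)
  rw [← card_stabU]
  have hSq : Nat.card (stabU H) ∣ q - 1 := by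
    have := Subgroup.card_subgroup_dvd_card (stabU H)
    rwa [Nat.card_units, Nat.card_eq_fintype_card (α := F), hq] at this
  -- overgroup structure
  have hover : ∀ K' : Subgroup (GL2 F), Sgrp (a:F) 0 H < K' → K' ≤ AGL F →
      ∃ (A : Subgroup Fˣ) (H1 : AddSubgroup F) (hst : ∀ u ∈ A, ∀ h ∈ H1, (u:F) * h ∈ H1),
      K' = GG A H1 hst ∧ Subgroup.zpowers a ≤ A ∧ H ≤ H1 ∧ (Subgroup.zpowers a = A → H ≠ H1) := by
    intro K' h1 h2
    rw [Sgrp_eq a H haH] at h1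
    obtain ⟨A, H1, hst, rfl⟩ := exists_GG a ha1 K' h2
      (h1.le (mem_GG.2 ⟨Subgroup.mem_zpowers a, H.zero_mem⟩))
    have h3 := GG_le.1 h1.le
    exact ⟨A, H1, hst, rfl, h3.1, h3.2, fun h4 h5 => h1.ne (GG_eq.2 ⟨h4, h5⟩)⟩
  have hstz : ∀ (c : Fˣ) (H1 : AddSubgroup F), c ∈ stabU H1 →
      ∀ u ∈ Subgroup.zpowers c, ∀ h ∈ H1, (u:F) * h ∈ H1 :=
    fun c H1 hc _ hu => mem_stabU.1 ((Subgroup.zpowers_le.2 hc) hu)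
  constructor
  · rintro ⟨⟨hlt, hA⟩, hmin⟩
    obtain ⟨A, H1, hst, rfl, hA1, hH1, hne⟩ := hover K hlt hA
    have haH1 : a ∈ stabU H1 := mem_stabU.2 (hst a (hA1 (Subgroup.mem_zpowers a)))
    by_cases hH : H = H1
    · left
      subst hH
      have hAS : A ≤ stabU H := fun u hu => mem_stabU.2 (hst u hu)
      have hdA : d ∣ Nat.card A := by rw [← hcd]; exact Subgroup.card_dvd_of_le hA1
      obtain ⟨m, hm⟩ := hdA
      have hm1 : m ≠ 1 := by
        rintro rfl
        refine hne ?_ rfl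
        exact Subgroup.eq_of_le_of_card_ge hA1 (by rw [hcd, hm, mul_one])
      obtain ⟨e, he, hem⟩ := Nat.exists_prime_and_dvd hm1
      have hdeA : d * e ∣ Nat.card A := by rw [hm]; exact Nat.mul_dvd_mul_left d hem
      have hdeS : d * e ∣ Nat.card (stabU H) := hdeA.trans (Subgroup.card_dvd_of_le hAS)
      have hco := hpo (d * e) (hdeS.trans hSq)
      refine ⟨e, he, ?_, ?_⟩
      · exact (Nat.dvd_div_iff_mul_dvd hdS).2 hdeS
      set c : Fˣ := g ^ ((q - 1) / (d * e)) with hc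
      have hcA : c ∈ A := mem_of_pow_card A c (orderOf_dvd_iff_pow_eq_one.1 (by rw [hco]; exact hdeA))
      have hac : a ∈ Subgroup.zpowers c := mem_of_pow_card _ a (orderOf_dvd_iff_pow_eq_one.1 (by
        rw [Nat.card_zpowers, hco, hao]; exact Nat.dvd_mul_right d e))
      rw [Sgrp_eq c H (hAS hcA)]
      symm
      apply hmin
      · refine ⟨?_, GG_le_AGL⟩
        rw [Sgrp_eq a H haH]
        refine lt_of_le_of_ne (GG_le.2 ⟨Subgroup.zpowers_le.2 hac, le_rfl⟩) ?_
        intro h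
        have h1 := (GG_eq.1 h).1
        have h2 : d = d * e := by
          rw [← hco, ← Nat.card_zpowers, ← h1, hcd]
        have := he.one_lt
        nlinarith
      · exact GG_le.2 ⟨Subgroup.zpowers_le.2 hcA, le_rfl⟩
    · right
      have hlt1 : H < H1 := lt_of_le_of_ne hH1 hH
      obtain ⟨x, hx1, hx⟩ := SetLike.exists_of_lt hlt1
      obtain ⟨H2, hHH2, hxH2, hkH2, hcard, huniv⟩ := exists_ext k H ((hkle H).2 haH) x hx
      have haH2 := (hkle H2).1 hkH2
      have h21 : H2 ≤ H1 := huniv H1 hH1 hx1 ((hkle H1).2 haH1)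
      have := hmin (GG (Subgroup.zpowers a) H2 (hstz a H2 haH2)) ⟨?_, GG_le_AGL⟩
        (GG_le.2 ⟨hA1, h21⟩)
      · refine ⟨H2, hHH2, (hmemS H2).2 haH2, by rw [hcard, hkc], ?_⟩
        rw [← this, Sgrp_eq a H2 haH2]
      · rw [Sgrp_eq a H haH]
        refine lt_of_le_of_ne (GG_le.2 ⟨le_rfl, hHH2⟩) ?_
        intro h
        have h1 := (GG_eq.1 h).2
        rw [← h1] at hxH2
        exact hx hxH2
  · rintro (⟨e, he, hediv, rfl⟩ | ⟨H1, hHH1, hS1, hcard, rfl⟩)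
    · have hdeS : d * e ∣ Nat.card (stabU H) := (Nat.dvd_div_iff_mul_dvd hdS).1 hediv
      have hco := hpo (d * e) (hdeS.trans hSq)
      set c : Fˣ := g ^ ((q - 1) / (d * e)) with hc
      have hcS : c ∈ stabU H := mem_of_pow_card _ c
        (orderOf_dvd_iff_pow_eq_one.1 (by rw [hco]; exact hdeS))
      have hac : a ∈ Subgroup.zpowers c := mem_of_pow_card _ a (orderOf_dvd_iff_pow_eq_one.1 (by
        rw [Nat.card_zpowers, hco, hao]; exact Nat.dvd_mul_right d e))
      have he1 := he.one_lt
      refine ⟨⟨?_, ?_⟩, ?_⟩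
      · rw [Sgrp_eq a H haH, Sgrp_eq c H hcS]
        refine lt_of_le_of_ne (GG_le.2 ⟨Subgroup.zpowers_le.2 hac, le_rfl⟩) ?_
        intro h
        have h1 := (GG_eq.1 h).1
        have h2 : d = d * e := by
          rw [← hco, ← Nat.card_zpowers, ← h1, hcd]
        nlinarith
      · rw [Sgrp_eq c H hcS]; exact GG_le_AGL
      · rintro K' ⟨hlt, hA⟩ hle
        obtain ⟨A, H2, hst, rfl, hA1, hH2, hne⟩ := hover K' hlt hA
        rw [Sgrp_eq c H hcS] at hle ⊢
        obtain ⟨hAc, hHc⟩ := GG_le.1 hle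
        have hHH : H = H2 := le_antisymm hH2 hHc
        refine GG_eq.2 ⟨?_, hHH.symm⟩
        have hdA : d ∣ Nat.card A := by rw [← hcd]; exact Subgroup.card_dvd_of_le hA1
        have hAde : Nat.card A ∣ d * e := by
          rw [← hco, ← Nat.card_zpowers]; exact Subgroup.card_dvd_of_le hAc
        obtain ⟨m, hm⟩ := hdA
        rw [hm] at hAde
        have hme : m ∣ e := Nat.dvd_of_mul_dvd_mul_left hd0 hAde
        rcases (Nat.dvd_prime he).1 hme with rfl | rfl
        · exfalso
          refine hne ?_ hHH
          exact Subgroup.eq_of_le_of_card_ge hA1 (by rw [hcd, hm, mul_one])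
        · exact Subgroup.eq_of_le_of_card_ge hAc (by rw [Nat.card_zpowers, hco, hm])
    · have haH1 := (hmemS H1).1 hS1
      refine ⟨⟨?_, ?_⟩, ?_⟩
      · rw [Sgrp_eq a H haH, Sgrp_eq a H1 haH1]
        refine lt_of_le_of_ne (GG_le.2 ⟨le_rfl, hHH1⟩) ?_
        intro h
        have h1 := (GG_eq.1 h).2
        rw [← h1, ← hkc] at hcard
        have : 0 < Nat.card H := Nat.card_pos
        nlinarith
      · rw [Sgrp_eq a H1 haH1]; exact GG_le_AGL
      · rintro K' ⟨hlt, hA⟩ hle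
        obtain ⟨A, H2, hst, rfl, hA1, hH2, hne⟩ := hover K' hlt hA
        rw [Sgrp_eq a H1 haH1] at hle ⊢
        obtain ⟨hAc, hHc⟩ := GG_le.1 hle
        have hAA := le_antisymm hA1 hAc
        have hlt1 : H < H2 := lt_of_le_of_ne hH2 (hne hAA)
        obtain ⟨x, hx1, hx⟩ := SetLike.exists_of_lt hlt1
        obtain ⟨H3, hHH3, hxH3, hkH3, hcard3, huniv⟩ := exists_ext k H ((hkle H).2 haH) x hx
        have haH2 : a ∈ stabU H2 := mem_stabU.2 (hst a (hA1 (Subgroup.mem_zpowers a)))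
        have h32 : H3 ≤ H2 := huniv H2 hH2 hx1 ((hkle H2).2 haH2)
        have h31 : H3 = H1 := AddSubgroup.eq_of_le_of_card_ge (h32.trans hHc)
          (by rw [hcard, hcard3, hkc])
        exact GG_eq.2 ⟨hAA.symm, le_antisymm hHc (h31 ▸ h32)⟩
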